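/- arXiv:2201.11611 — 2 statements merged into one kernel-verified Lean document; each statement's English description precedes it below -/
import Mathlib

section
/- Let K, α, t̂, and t_k be natural numbers with 1 ≤ α, t̂ + α ≤ K, and t̂ ≤ t_k ≤ K − 1. Then K · C(K−1, t̂+α−1) · C(t̂+α−1, t̂) · C(K−t̂−1, t_k−t̂) = (K − t_k) · C(K, t_k) · C(t_k, t̂) · C(K−t̂−1, α−1); equivalently, as rational numbers, [C(K−1, t̂+α−1) · C(t̂+α−1, t̂) · C(K−t̂−1, t_k−t̂)] / [C(K, t_k) · C(t_k, t̂) · C(K−t̂−1, α−1)] = (K − t_k)/K. (This is the identity establishing Lemma 1: the total amount of data delivered to user k over all transmissions equals 1 − m_k = (K − t_k)/K data units, so every user receives its requested data.) -/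
/-- Lemma 1 identity: the total amount of data delivered to user `k` over all
transmissions equals `1 - m_k = (K - t_k)/K` data units. Stated both as a
natural-number identity and as the equivalent rational identity. -/
theorem stmt_0 (K α th tk : ℕ) (hα : 1 ≤ α) (hKα : th + α ≤ K)
    (h1 : th ≤ tk) (h2 : tk ≤ K - 1) :
    K * Nat.choose (K - 1) (th + α - 1) * Nat.choose (th + α - 1) th *
        Nat.choose (K - th - 1) (tk - th)
      = (K - tk) * Nat.choose K tk * Nat.choose tk th *
        Nat.choose (K - th - 1) (α - 1) ∧
    ((Nat.choose (K - 1) (th + α - 1) : ℚ) * Nat.choose (th + α - 1) th *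
        Nat.choose (K - th - 1) (tk - th)) /
      ((Nat.choose K tk : ℚ) * Nat.choose tk th * Nat.choose (K - th - 1) (α - 1))
      = ((K : ℚ) - tk) / K := by
  have key : K * Nat.choose (K - 1) (th + α - 1) * Nat.choose (th + α - 1) th *
        Nat.choose (K - th - 1) (tk - th)
      = (K - tk) * Nat.choose K tk * Nat.choose tk th *
        Nat.choose (K - th - 1) (α - 1) := by
    obtain ⟨a, rfl⟩ : ∃ a, α = a + 1 := ⟨α - 1, by omega⟩
    obtain ⟨n, rfl⟩ : ∃ n, K = n + 1 := ⟨K - 1, by omega⟩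
    have e1 : n + 1 - th - 1 = n - th := by omega
    have e2 : th + (a + 1) - 1 = th + a := by omega
    simp only [e1, e2, Nat.add_sub_cancel] at *
    have A : n.choose (th + a) * (th + a).choose th = n.choose th * (n - th).choose a := by
      have := Nat.choose_mul (n := n) (k := th + a) (s := th) (by omega)
      rwa [Nat.add_sub_cancel_left] at this
    have B : n.choose tk * tk.choose th = n.choose th * (n - th).choose (tk - th) :=
      Nat.choose_mul h1
    have C := Nat.choose_mul_succ_eq n tk
    calc _ = (n + 1) * (n.choose (th + a) * (th + a).choose th)
            * (n - th).choose (tk - th) := by ring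
      _ = (n + 1) * (n.choose th * (n - th).choose (tk - th)) * (n - th).choose a := by
          rw [A]; ring
      _ = (n.choose tk * (n + 1)) * tk.choose th * (n - th).choose a := by rw [← B]; ring
      _ = _ := by rw [C]; ring
  refine ⟨key, ?_⟩
  have p1 : (Nat.choose K tk : ℚ) ≠ 0 := by
    exact_mod_cast (Nat.choose_pos (by omega)).ne'
  have p2 : (Nat.choose tk th : ℚ) ≠ 0 := by
    exact_mod_cast (Nat.choose_pos h1).ne'
  have p3 : (Nat.choose (K - th - 1) (α - 1) : ℚ) ≠ 0 := by
    exact_mod_cast (Nat.choose_pos (by omega)).ne'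
  have p4 : (K : ℚ) ≠ 0 := by
    have : K ≠ 0 := by omega
    exact_mod_cast this
  have kq := congrArg (Nat.cast : ℕ → ℚ) key
  have hk : tk ≤ K := by omega
  push_cast [Nat.cast_sub hk] at kq
  rw [div_eq_div_iff (mul_ne_zero (mul_ne_zero p1 p2) p3) p4]
  linear_combination kq
end

section
/- Let K, L, t̂ be natural numbers with L ≥ 1 and t̂ + L ≤ K, and let t_k be a real number with t̂ ≤ ⌊t_k⌋ and ⌊t_k⌋ + 1 ≤ K − 1; write u = ⌊t_k⌋. Then [C(K−1, t̂+L−1) · C(t̂+L−1, t̂) · C(K−t̂−1, u−t̂) / (C(K, u) · C(u, t̂) · C(K−t̂−1, L−1))] · (u + 1 − t_k) + [C(K−1, t̂+L−1) · C(t̂+L−1, t̂) · C(K−t̂−1, u+1−t̂) / (C(K, u+1) · C(u+1, t̂) · C(K−t̂−1, L−1))] · (t_k − u) = (K − t_k)/K, where C(n, m) denotes the binomial coefficient. (This is the appendix identity showing that under the memory-sharing scheme with non-integer t_k, the delivery phase serves user k with exactly 1 − m(s_k) = (K − t_k)/K data units, i.e., user k receives its missing file parts entirely.) -/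
theorem aux_ratio (n l th u : ℕ) (hl : th + l ≤ n) (h1 : th ≤ u) (h2 : u ≤ n) :
    ((Nat.choose n (th + l) : ℝ) * (Nat.choose (th + l) th : ℝ) *
          (Nat.choose (n - th) (u - th) : ℝ) /
        ((Nat.choose (n + 1) u : ℝ) * (Nat.choose u th : ℝ) *
          (Nat.choose (n - th) l : ℝ))) = ((n : ℝ) + 1 - u) / (n + 1) := by
  have e1 : n.choose (th + l) * (th + l).choose th = n.choose th * (n - th).choose l := by
    rw [Nat.choose_mul (by omega)]
    congr 2
    omega
  have e2 : n.choose u * u.choose th = n.choose th * (n - th).choose (u - th) :=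
    Nat.choose_mul (by omega)
  have e3 := Nat.choose_mul_succ_eq n u
  have p1 : ((n + 1).choose u : ℝ) ≠ 0 := by exact_mod_cast (Nat.choose_pos (by omega)).ne'
  have p2 : (u.choose th : ℝ) ≠ 0 := by exact_mod_cast (Nat.choose_pos (by omega)).ne'
  have p3 : ((n - th).choose l : ℝ) ≠ 0 := by exact_mod_cast (Nat.choose_pos (by omega)).ne'
  have p4 : (n : ℝ) + 1 ≠ 0 := by positivity
  have f1 := congrArg (Nat.cast (R := ℝ)) e1
  have f2 := congrArg (Nat.cast (R := ℝ)) e2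
  have f3 := congrArg (Nat.cast (R := ℝ)) e3
  rw [Nat.cast_mul, Nat.cast_mul, Nat.cast_sub (by omega)] at f3
  push_cast at f1 f2 f3
  rw [div_eq_div_iff (by positivity) p4, f1]
  linear_combination (-((n - th).choose l : ℝ) * (n + 1)) * f2 +
    ((n - th).choose l : ℝ) * (u.choose th : ℝ) * f3

/-- Appendix identity: under the memory-sharing scheme with non-integer `t_k`,
the delivery phase serves user `k` with exactly `1 − m(s_k) = (K − t_k)/K`
data units, i.e. user `k` receives its missing file parts entirely.
Here `u = ⌊t_k⌋`. -/
theorem stmt_9 (K L th : ℕ) (hL : 1 ≤ L) (hKL : th + L ≤ K) (tk : ℝ)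
    (h1 : th ≤ ⌊tk⌋₊) (h2 : ⌊tk⌋₊ + 1 ≤ K - 1) :
    ((Nat.choose (K - 1) (th + L - 1) : ℝ) * (Nat.choose (th + L - 1) th : ℝ) *
          (Nat.choose (K - th - 1) (⌊tk⌋₊ - th) : ℝ) /
        ((Nat.choose K ⌊tk⌋₊ : ℝ) * (Nat.choose ⌊tk⌋₊ th : ℝ) *
          (Nat.choose (K - th - 1) (L - 1) : ℝ))) *
        ((⌊tk⌋₊ : ℝ) + 1 - tk)
      + ((Nat.choose (K - 1) (th + L - 1) : ℝ) * (Nat.choose (th + L - 1) th : ℝ) *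
          (Nat.choose (K - th - 1) (⌊tk⌋₊ + 1 - th) : ℝ) /
        ((Nat.choose K (⌊tk⌋₊ + 1) : ℝ) * (Nat.choose (⌊tk⌋₊ + 1) th : ℝ) *
          (Nat.choose (K - th - 1) (L - 1) : ℝ))) *
        (tk - (⌊tk⌋₊ : ℝ))
      = ((K : ℝ) - tk) / K := by
  obtain ⟨n, rfl⟩ : ∃ n, K = n + 1 := ⟨K - 1, by omega⟩
  obtain ⟨l, rfl⟩ : ∃ l, L = l + 1 := ⟨L - 1, by omega⟩
  generalize ⌊tk⌋₊ = u at *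
  have a1 : n + 1 - th - 1 = n - th := by omega
  have a2 : th + (l + 1) - 1 = th + l := by omega
  simp only [a1, a2, Nat.add_sub_cancel] at *
  rw [aux_ratio n l th u (by omega) h1 (by omega),
    aux_ratio n l th (u + 1) (by omega) (by omega) (by omega)]
  have p4 : (n : ℝ) + 1 ≠ 0 := by positivity
  push_cast
  field_simp
  ring
end
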